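/- arXiv:2210.00184 — 6 statements merged into one kernel-verified Lean document; each statement's English description precedes it below -/
import Mathlib

section
/- Let d ≥ 1 and 1 ≤ K ≤ d be natural numbers, and let a₁ ≥ a₂ ≥ … ≥ a_d ≥ 0 be a nonincreasing sequence of nonnegative real numbers. Then sqrt(Σ_{i=K+1}^{d} aᵢ²) ≤ (1 − K/(2d)) · sqrt(Σ_{i=1}^{d} aᵢ²). -/
/-- The last `d - K` terms of a nonincreasing sequence of length `d` make up at most the fraction
`(d - K) / d` of its total sum. -/
theorem AntitoneOn.mul_sum_Icc_succ_le {f : ℕ → ℝ} {d K : ℕ} (hf : AntitoneOn f (Set.Icc 1 d))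
    (hK : 1 ≤ K) (hKd : K ≤ d) :
    (d : ℝ) * ∑ i ∈ Finset.Icc (K + 1) d, f i ≤ (d - K) * ∑ i ∈ Finset.Icc 1 d, f i := by
  have split : ∑ i ∈ Finset.Icc 1 d, f i
      = ∑ i ∈ Finset.Icc 1 K, f i + ∑ i ∈ Finset.Icc (K + 1) d, f i := by
    rw [← Finset.sum_union]
    · congr 1
      ext i
      simp only [Finset.mem_union, Finset.mem_Icc]
      omega
    · rw [Finset.disjoint_left]
      intro i
      simp only [Finset.mem_Icc]
      omega
  have head : (K : ℝ) * f K ≤ ∑ i ∈ Finset.Icc 1 K, f i := by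
    have h := Finset.card_nsmul_le_sum (Finset.Icc 1 K) f (f K) fun i hi ↦ by
      rw [Finset.mem_Icc] at hi
      exact hf ⟨hi.1, hi.2.trans hKd⟩ ⟨hK, hKd⟩ hi.2
    simpa using h
  have tail : ∑ i ∈ Finset.Icc (K + 1) d, f i ≤ ((d : ℝ) - K) * f K := by
    have h := Finset.sum_le_card_nsmul (Finset.Icc (K + 1) d) f (f K) fun i hi ↦ by
      rw [Finset.mem_Icc] at hi
      exact hf ⟨hK, hKd⟩ ⟨by omega, hi.2⟩ (by omega)
    simpa [Nat.cast_sub hKd] using h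
  have hKd' : (0 : ℝ) ≤ d - K := sub_nonneg.2 (Nat.cast_le.2 hKd)
  rw [split]
  linarith [mul_le_mul_of_nonneg_left head hKd', mul_le_mul_of_nonneg_left tail K.cast_nonneg]

/-- Proposition 1 (Rank-K compression), core inequality: for a nonincreasing
sequence `a 1 ≥ a 2 ≥ … ≥ a d ≥ 0`,
`sqrt (∑_{i=K+1}^d (a i)^2) ≤ (1 - K/(2d)) * sqrt (∑_{i=1}^d (a i)^2)`. -/
theorem stmt_0 (d K : ℕ) (hd : 1 ≤ d) (hK1 : 1 ≤ K) (hKd : K ≤ d)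
    (a : ℕ → ℝ)
    (hnn : ∀ i, 1 ≤ i → i ≤ d → 0 ≤ a i)
    (hmono : ∀ i j, 1 ≤ i → i ≤ j → j ≤ d → a j ≤ a i) :
    Real.sqrt (∑ i ∈ Finset.Icc (K + 1) d, (a i) ^ 2) ≤
      (1 - (K : ℝ) / (2 * d)) * Real.sqrt (∑ i ∈ Finset.Icc 1 d, (a i) ^ 2) := by
  have hd0 : (0 : ℝ) < d := by exact_mod_cast hd
  have hKd' : (K : ℝ) ≤ d := by exact_mod_cast hKd
  have hanti : AntitoneOn (fun i ↦ a i ^ 2) (Set.Icc 1 d) := fun i hi j hj hij ↦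
    pow_le_pow_left₀ (hnn j hj.1 hj.2) (hmono i j hi.1 hij hj.2) 2
  have htail := hanti.mul_sum_Icc_succ_le hK1 hKd
  have hsum : 0 ≤ ∑ i ∈ Finset.Icc 1 d, a i ^ 2 := Finset.sum_nonneg fun i _ ↦ sq_nonneg (a i)
  have hcoef : 0 ≤ 1 - (K : ℝ) / (2 * d) := by
    rw [sub_nonneg, div_le_one (by positivity)]
    linarith
  refine Real.sqrt_le_iff.2 ⟨mul_nonneg hcoef (Real.sqrt_nonneg _), ?_⟩
  rw [mul_pow, Real.sq_sqrt hsum]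
  calc ∑ i ∈ Finset.Icc (K + 1) d, a i ^ 2
      ≤ (1 - (K : ℝ) / d) * ∑ i ∈ Finset.Icc 1 d, a i ^ 2 := by
        rw [one_sub_div hd0.ne', div_mul_eq_mul_div, le_div_iff₀ hd0]
        linarith
    _ ≤ (1 - (K : ℝ) / (2 * d)) ^ 2 * ∑ i ∈ Finset.Icc 1 d, a i ^ 2 := by
        gcongr
        have h : (K : ℝ) / d = 2 * (K / (2 * d)) := by field_simp
        rw [h]
        linarith [sq_nonneg ((K : ℝ) / (2 * d))]
end

section
/- Let d ≥ 1 and 1 ≤ K ≤ d² be natural numbers, let A be a d×d real matrix, and let S be a set of exactly K index pairs (i,j) ∈ {1,…,d}×{1,…,d} such that |A_{pq}| ≤ |A_{ij}| for every (i,j) ∈ S and every (p,q) ∉ S. Then sqrt(Σ_{(p,q)∉S} A_{pq}²) ≤ (1 − K/(2d²)) · ‖A‖_F. -/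
/-- If every value of `f` on `t` is at most every value of `f` on `s`, then the average of `f`
over `t` is at most its average over `s`. -/
lemma Finset.card_mul_sum_le_card_mul_sum {ι : Type*} (s t : Finset ι) (f : ι → ℝ)
    (h : ∀ p ∈ s, ∀ q ∈ t, f q ≤ f p) :
    (s.card : ℝ) * ∑ q ∈ t, f q ≤ t.card * ∑ p ∈ s, f p := by
  calc (s.card : ℝ) * ∑ q ∈ t, f q = ∑ _p ∈ s, ∑ q ∈ t, f q := by simp
    _ ≤ ∑ p ∈ s, ∑ _q ∈ t, f p :=
      Finset.sum_le_sum fun p hp => Finset.sum_le_sum fun q hq => h p hp q hq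
    _ = t.card * ∑ p ∈ s, f p := by simp [Finset.mul_sum]

/-- Proposition 1 (Top-K compression): if `S` consists of `K` index pairs of a
`d × d` real matrix `A` whose entries dominate (in absolute value) all entries
outside `S`, then the Frobenius norm of the part of `A` outside `S` is at most
`(1 - K/(2d²))` times the Frobenius norm of `A`. -/
theorem stmt_1 (d K : ℕ) (hd : 1 ≤ d) (hK1 : 1 ≤ K) (hKd : K ≤ d ^ 2)
    (A : Matrix (Fin d) (Fin d) ℝ) (S : Finset (Fin d × Fin d)) (hcard : S.card = K)
    (hS : ∀ p ∈ S, ∀ q, q ∉ S → |A q.1 q.2| ≤ |A p.1 p.2|) :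
    Real.sqrt (∑ q ∈ Sᶜ, (A q.1 q.2) ^ 2) ≤
      (1 - (K : ℝ) / (2 * (d : ℝ) ^ 2)) *
        Real.sqrt (∑ p : Fin d × Fin d, (A p.1 p.2) ^ 2) := by
  have hd0 : (0 : ℝ) < (d : ℝ) ^ 2 := by positivity
  have hKd' : (K : ℝ) ≤ (d : ℝ) ^ 2 := by exact_mod_cast hKd
  have hcompl : ((Sᶜ).card : ℝ) = (d : ℝ) ^ 2 - K := by
    have h := Finset.card_add_card_compl S
    rw [hcard, Fintype.card_prod, Fintype.card_fin, ← sq] at h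
    rw [eq_sub_iff_add_eq']
    exact_mod_cast h
  have havg := Finset.card_mul_sum_le_card_mul_sum S Sᶜ (fun p => (A p.1 p.2) ^ 2)
    fun p hp q hq => sq_le_sq.2 (hS p hp q (Finset.mem_compl.1 hq))
  have hsplit := Finset.sum_add_sum_compl S (fun p => (A p.1 p.2) ^ 2)
  rw [hcompl, hcard] at havg
  have htotal : 0 ≤ ∑ p : Fin d × Fin d, (A p.1 p.2) ^ 2 :=
    Finset.sum_nonneg fun _ _ => sq_nonneg _
  have hratio : (K : ℝ) / (d : ℝ) ^ 2 ≤ 1 := (div_le_one hd0).2 hKd'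
  have hhalf : (K : ℝ) / (2 * (d : ℝ) ^ 2) = (K : ℝ) / (d : ℝ) ^ 2 / 2 := by
    field_simp
  have hout : ∑ q ∈ Sᶜ, (A q.1 q.2) ^ 2 ≤
      (1 - (K : ℝ) / (d : ℝ) ^ 2) * ∑ p : Fin d × Fin d, (A p.1 p.2) ^ 2 := by
    rw [one_sub_div hd0.ne', div_mul_eq_mul_div, le_div_iff₀ hd0, ← hsplit]
    linarith
  rw [hhalf]
  refine Real.sqrt_le_iff.2 ⟨mul_nonneg (by linarith) (Real.sqrt_nonneg _), hout.trans ?_⟩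
  rw [mul_pow, Real.sq_sqrt htotal]
  gcongr
  nlinarith [sq_nonneg ((K : ℝ) / (d : ℝ) ^ 2)]
end

section
/- Let m ≥ 1 be an integer, α ≥ 0, and let X and D be n×d real matrices. Define X' = W^m * (X − α·D). Then ‖X' − P*X'‖_F ≤ σ^m (‖X − P*X‖_F + α‖D − P*D‖_F). -/
/-- Frobenius norm of an `n × d` real matrix. -/
noncomputable def frob {n d : ℕ} (X : Matrix (Fin n) (Fin d) ℝ) : ℝ :=
  Real.sqrt (∑ i, ∑ j, (X i j) ^ 2)

section Frobenius

variable {n d : ℕ}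

attribute [local instance] Matrix.frobeniusNormedAddCommGroup Matrix.frobeniusNormedSpace

theorem frob_eq_norm (X : Matrix (Fin n) (Fin d) ℝ) : frob X = ‖X‖ := by
  simp [frob, Matrix.frobenius_norm_def, Real.sqrt_eq_rpow]

theorem frob_sub_le (X Y : Matrix (Fin n) (Fin d) ℝ) : frob (X - Y) ≤ frob X + frob Y := by
  simpa only [frob_eq_norm] using norm_sub_le X Y

theorem frob_smul {a : ℝ} (ha : 0 ≤ a) (X : Matrix (Fin n) (Fin d) ℝ) :
    frob (a • X) = a * frob X := by
  rw [frob_eq_norm, frob_eq_norm, norm_smul, Real.norm_of_nonneg ha]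

end Frobenius

/-- A Euclidean operator bound for `A` bounds left multiplication by `A` in Frobenius norm. -/
theorem frob_mul_le_of_mulVec_le {n d : ℕ} {σ : ℝ} (hσ : 0 ≤ σ) {A : Matrix (Fin n) (Fin n) ℝ}
    (hA : ∀ v : Fin n → ℝ,
      Real.sqrt (∑ i, (A.mulVec v i) ^ 2) ≤ σ * Real.sqrt (∑ i, (v i) ^ 2))
    (X : Matrix (Fin n) (Fin d) ℝ) : frob (A * X) ≤ σ * frob X := by
  unfold frob
  rw [Real.sqrt_le_left (by positivity), mul_pow, Real.sq_sqrt (by positivity),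
    Finset.sum_comm, Finset.sum_comm (f := fun i j => X i j ^ 2), Finset.mul_sum]
  refine Finset.sum_le_sum fun j _ => ?_
  have h := (Real.sqrt_le_left (by positivity)).1 (hA fun i => X i j)
  rwa [mul_pow, Real.sq_sqrt (by positivity)] at h

/-- If `P` is idempotent and absorbs `W` on both sides, then `1 - P` intertwines `W` and `W - P`. -/
theorem mul_sub_mul_mul_eq {n d : ℕ} {W P : Matrix (Fin n) (Fin n) ℝ}
    (hPP : P * P = P) (hWP : W * P = P) (hPW : P * W = P) (Y : Matrix (Fin n) (Fin d) ℝ) :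
    W * Y - P * (W * Y) = (W - P) * (Y - P * Y) := by
  rw [Matrix.mul_sub, Matrix.sub_mul, ← Matrix.mul_assoc (W - P), Matrix.sub_mul W P P, hPP, hWP,
    ← Matrix.mul_assoc, hPW, sub_self, Matrix.zero_mul, sub_zero]

theorem frob_pow_mul_sub_le {n d : ℕ} {σ : ℝ} (hσ : 0 ≤ σ) {W P : Matrix (Fin n) (Fin n) ℝ}
    (hPP : P * P = P) (hWP : W * P = P) (hPW : P * W = P)
    (hσW : ∀ v : Fin n → ℝ,
      Real.sqrt (∑ i, ((W - P).mulVec v i) ^ 2) ≤ σ * Real.sqrt (∑ i, (v i) ^ 2))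
    (m : ℕ) (Y : Matrix (Fin n) (Fin d) ℝ) :
    frob (W ^ m * Y - P * (W ^ m * Y)) ≤ σ ^ m * frob (Y - P * Y) := by
  induction m with
  | zero => simp
  | succ k ih =>
    rw [pow_succ', Matrix.mul_assoc, mul_sub_mul_mul_eq hPP hWP hPW, pow_succ', mul_assoc]
    exact (frob_mul_le_of_mulVec_le hσ hσW _).trans (mul_le_mul_of_nonneg_left ih hσ)

/-- Lemma 1, first inequality: for `X' = W^m * (X - α D)`,
`‖X' - P X'‖_F ≤ σ^m (‖X - P X‖_F + α ‖D - P D‖_F)`. -/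
theorem stmt_3 (n d m : ℕ) (hn : 1 ≤ n) (hm : 1 ≤ m) (α σ : ℝ)
    (hα : 0 ≤ α) (hσ : 0 ≤ σ)
    (W P : Matrix (Fin n) (Fin n) ℝ)
    (hWnn : ∀ i j, 0 ≤ W i j) (hWsymm : W.IsSymm) (hWrow : ∀ i, ∑ j, W i j = 1)
    (hP : ∀ i j, P i j = 1 / (n : ℝ))
    (hσW : ∀ v : Fin n → ℝ,
      Real.sqrt (∑ i, ((W - P).mulVec v i) ^ 2) ≤ σ * Real.sqrt (∑ i, (v i) ^ 2))
    (X D X' : Matrix (Fin n) (Fin d) ℝ)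
    (hX' : X' = W ^ m * (X - α • D)) :
    frob (X' - P * X') ≤ σ ^ m * (frob (X - P * X) + α * frob (D - P * D)) := by
  have hn0 : (n : ℝ) ≠ 0 := by positivity
  have hPP : P * P = P := by
    ext i j
    simp [Matrix.mul_apply, hP, hn0]
  have hWP : W * P = P := by
    ext i j
    simp [Matrix.mul_apply, hP, ← Finset.sum_mul, hWrow]
  have hPW : P * W = P := by
    ext i j
    simp [Matrix.mul_apply, hP, ← Finset.mul_sum, ← hWsymm.apply _ j, hWrow]
  subst hX'
  refine (frob_pow_mul_sub_le hσ hPP hWP hPW hσW m _).trans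
    (mul_le_mul_of_nonneg_left ?_ (pow_nonneg hσ m))
  have hcenter : X - α • D - P * (X - α • D) = (X - P * X) - α • (D - P * D) := by
    rw [Matrix.mul_sub, Matrix.mul_smul, smul_sub]
    abel
  rw [hcenter, ← frob_smul hα]
  exact frob_sub_le _ _
end

section
/- Let x₁,…,xₙ and g₁,…,gₙ be points of ℝ^d such that (1/n)Σᵢ gᵢ = (1/n)Σᵢ ∇fᵢ(xᵢ), and write ḡ = (1/n)Σᵢ gᵢ and x̄ = (1/n)Σᵢ xᵢ. Then sqrt(Σᵢ ‖gᵢ‖²) ≤ sqrt(Σᵢ ‖gᵢ − ḡ‖²) + L₁ · sqrt(Σᵢ ‖xᵢ − x̄‖²) + √n · ‖∇F(x̄)‖. -/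
/-- Minkowski's inequality for finite families in the `ℓ²` norm. -/
theorem sqrt_sum_norm_add_sq_le {ι E : Type*} [Fintype ι] [SeminormedAddCommGroup E]
    (u v : ι → E) :
    Real.sqrt (∑ i, ‖u i + v i‖ ^ 2) ≤
      Real.sqrt (∑ i, ‖u i‖ ^ 2) + Real.sqrt (∑ i, ‖v i‖ ^ 2) := by
  simpa [PiLp.norm_eq_of_L2] using norm_add_le (WithLp.toLp 2 u) (WithLp.toLp 2 v)

theorem sum_le_sqrt_card_mul_sqrt_sum_sq {ι : Type*} [Fintype ι] (a : ι → ℝ) :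
    ∑ i, a i ≤ Real.sqrt (Fintype.card ι) * Real.sqrt (∑ i, a i ^ 2) := by
  rw [← Real.sqrt_mul (Nat.cast_nonneg _)]
  exact Real.le_sqrt_of_sq_le (sq_sum_le_card_mul_sum_sq (s := Finset.univ) (f := a))

theorem gradient_const_mul_sum {ι E : Type*} [Fintype ι] [NormedAddCommGroup E]
    [InnerProductSpace ℝ E] [CompleteSpace E] (c : ℝ) {f : ι → E → ℝ} {y : E}
    (hf : ∀ i, DifferentiableAt ℝ (f i) y) :
    gradient (fun z => c * ∑ i, f i z) y = c • ∑ i, gradient (f i) y := by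
  have h := (HasFDerivAt.fun_sum (u := Finset.univ) fun i _ => (hf i).hasFDerivAt).const_mul c
  simp only [gradient, h.fderiv, map_smul, map_sum]

/-- Inequality (ineq:gknorm) of Lemma 2: if `(1/n) ∑ᵢ gᵢ = (1/n) ∑ᵢ ∇fᵢ(xᵢ)`,
then `√(∑ᵢ ‖gᵢ‖²) ≤ √(∑ᵢ ‖gᵢ - ḡ‖²) + L₁ √(∑ᵢ ‖xᵢ - x̄‖²) + √n ‖∇F(x̄)‖`. -/
theorem stmt_6 (n d : ℕ) (hn : 1 ≤ n) (L₁ : ℝ) (hL₁ : 0 < L₁)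
    (f : Fin n → EuclideanSpace ℝ (Fin d) → ℝ)
    (hdiff : ∀ i, Differentiable ℝ (f i))
    (hLip : ∀ i (a b : EuclideanSpace ℝ (Fin d)),
      ‖gradient (f i) a - gradient (f i) b‖ ≤ L₁ * ‖a - b‖)
    (F : EuclideanSpace ℝ (Fin d) → ℝ)
    (hF : F = fun y => (n : ℝ)⁻¹ * ∑ i, f i y)
    (x g : Fin n → EuclideanSpace ℝ (Fin d))
    (hg : (n : ℝ)⁻¹ • (∑ i, g i) = (n : ℝ)⁻¹ • (∑ i, gradient (f i) (x i)))
    (xbar gbar : EuclideanSpace ℝ (Fin d))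
    (hxbar : xbar = (n : ℝ)⁻¹ • ∑ i, x i)
    (hgbar : gbar = (n : ℝ)⁻¹ • ∑ i, g i) :
    Real.sqrt (∑ i, ‖g i‖ ^ 2) ≤
      Real.sqrt (∑ i, ‖g i - gbar‖ ^ 2) + L₁ * Real.sqrt (∑ i, ‖x i - xbar‖ ^ 2)
        + Real.sqrt n * ‖gradient F xbar‖ := by
  have hn' : (0 : ℝ) < n := by exact_mod_cast hn
  have hsqrt : 0 < Real.sqrt n := Real.sqrt_pos.2 hn'
  have hmink : Real.sqrt (∑ i, ‖g i‖ ^ 2) ≤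
      Real.sqrt (∑ i, ‖g i - gbar‖ ^ 2) + Real.sqrt n * ‖gbar‖ := by
    simpa [Real.sqrt_mul hn'.le] using
      sqrt_sum_norm_add_sq_le (fun i => g i - gbar) (fun _ => gbar)
  have hgrad : gradient F xbar = (n : ℝ)⁻¹ • ∑ i, gradient (f i) xbar := by
    rw [hF]
    exact gradient_const_mul_sum _ fun i => hdiff i xbar
  have hdev : ‖gbar - gradient F xbar‖ ≤ (n : ℝ)⁻¹ * (L₁ * ∑ i, ‖x i - xbar‖) := by
    rw [hgbar, hg, hgrad, ← smul_sub, ← Finset.sum_sub_distrib, norm_smul,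
      Real.norm_of_nonneg (inv_nonneg.2 hn'.le), Finset.mul_sum]
    gcongr
    exact norm_sum_le_of_le _ fun i _ => hLip i _ _
  have hcs : ∑ i, ‖x i - xbar‖ ≤ Real.sqrt n * Real.sqrt (∑ i, ‖x i - xbar‖ ^ 2) := by
    simpa using sum_le_sqrt_card_mul_sqrt_sum_sq fun i => ‖x i - xbar‖
  have hmain : Real.sqrt n * ‖gbar - gradient F xbar‖ ≤
      L₁ * Real.sqrt (∑ i, ‖x i - xbar‖ ^ 2) :=
    calc Real.sqrt n * ‖gbar - gradient F xbar‖
        ≤ Real.sqrt n * ((n : ℝ)⁻¹ *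
            (L₁ * (Real.sqrt n * Real.sqrt (∑ i, ‖x i - xbar‖ ^ 2)))) := by
          gcongr
          exact hdev.trans (by gcongr)
      _ = (Real.sqrt n * Real.sqrt n) * (n : ℝ)⁻¹ *
            (L₁ * Real.sqrt (∑ i, ‖x i - xbar‖ ^ 2)) := by ring
      _ = L₁ * Real.sqrt (∑ i, ‖x i - xbar‖ ^ 2) := by
          rw [Real.mul_self_sqrt hn'.le, mul_inv_cancel₀ hn'.ne', one_mul]
  have htri : ‖gbar‖ ≤ ‖gbar - gradient F xbar‖ + ‖gradient F xbar‖ := by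
    simpa using norm_add_le (gbar - gradient F xbar) (gradient F xbar)
  linarith [mul_le_mul_of_nonneg_left htri hsqrt.le]
end

section
/- Let 0 < δ < 1, 0 ≤ σ < 1, and 0 < γ ≤ δ²(1 − σ)/50. Set w₁ = δ(1 − σ)/(8(1 − δ)), w₂ = (1 − σ)/4, w₃ = 1. Then the following three inequalities hold: (i) (1 − δ)w₁ + 4γ w₂ + 4γ w₃ ≤ (1 − γ(1 − σ)/2) w₁; (ii) (1 − δ)w₁ + (1 − δ + 2γ(1 − δ)) w₂ + 2γ(1 − δ) w₃ ≤ (1 − γ(1 − σ)/2) w₂; (iii) 2γ w₂ + (1 − γ(1 − σ)) w₃ ≤ (1 − γ(1 − σ)/2) w₃. -/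
/-- The weight vector `w = (δ(1-σ)/(8(1-δ)), (1-σ)/4, 1)` satisfies
`wᵀ J² ≤ (1 - γ(1-σ)/2) wᵀ` componentwise, for `0 < γ ≤ δ²(1-σ)/50`. -/
theorem stmt_12 (δ σ γ : ℝ) (hδ0 : 0 < δ) (hδ1 : δ < 1)
    (hσ0 : 0 ≤ σ) (hσ1 : σ < 1)
    (hγ0 : 0 < γ) (hγ : γ ≤ δ ^ 2 * (1 - σ) / 50)
    (w₁ w₂ w₃ : ℝ)
    (hw₁ : w₁ = δ * (1 - σ) / (8 * (1 - δ)))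
    (hw₂ : w₂ = (1 - σ) / 4) (hw₃ : w₃ = 1) :
    ((1 - δ) * w₁ + 4 * γ * w₂ + 4 * γ * w₃ ≤ (1 - γ * (1 - σ) / 2) * w₁) ∧
    ((1 - δ) * w₁ + (1 - δ + 2 * γ * (1 - δ)) * w₂ + 2 * γ * (1 - δ) * w₃ ≤
      (1 - γ * (1 - σ) / 2) * w₂) ∧
    (2 * γ * w₂ + (1 - γ * (1 - σ)) * w₃ ≤ (1 - γ * (1 - σ) / 2) * w₃) := by
  subst hw₂ hw₃
  obtain ⟨s, rfl⟩ : ∃ s, σ = 1 - s := ⟨1 - σ, by ring⟩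
  simp only [sub_sub_cancel] at *
  have hs0 : 0 < s := by linarith
  have hs1 : s ≤ 1 := by linarith
  have hδs : 0 < δ * s := mul_pos hδ0 hs0
  have hδsq : δ ^ 2 * s ≤ δ * s := by nlinarith
  have hδs_le : δ * s ≤ δ := mul_le_of_le_one_right hδ0.le hs1
  have hγs : γ * s ≤ γ := mul_le_of_le_one_right hγ0.le hs1
  have hw₁_mul : (1 - δ) * w₁ = δ * s / 8 := by
    have : 1 - δ ≠ 0 := by linarith
    rw [hw₁]
    field_simp
  have hw₁_ge : δ * s / 8 ≤ w₁ := by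
    rw [hw₁]
    exact div_le_div_of_nonneg_left hδs.le (by linarith) (by linarith)
  refine ⟨?_, ?_, by linarith⟩
  · have hrate : 99 / 100 * δ ≤ δ - γ * s / 2 := by linarith
    have hprod : 99 / 100 * δ * (δ * s / 8) ≤ (δ - γ * s / 2) * w₁ :=
      mul_le_mul hrate hw₁_ge (by positivity) (by linarith)
    linarith
  · have hγss : γ * s * s ≤ γ := (mul_le_of_le_one_right (by positivity) hs1).trans hγs
    have hγδ : 0 ≤ γ * δ := by positivity
    have hγδs : 0 ≤ γ * δ * s := by positivity
    linarith
end

section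
/- Let 0 < σ < 1, m ≥ 1 an integer, α ≥ 0, M₁ > 0, and let X, D, G be n×d real matrices with ‖D‖_F ≤ (2/M₁)‖G‖_F. Define X' = W^m * (X − α·D). Then ‖X' − P*X'‖_F² ≤ σ^{2m−2}·((1 + σ²)/2)·‖X − P*X‖_F² + (8 σ^{2m} α² / ((1 − σ²) M₁²))·‖G‖_F². -/
theorem frob_sq {n d : ℕ} (X : Matrix (Fin n) (Fin d) ℝ) :
    frob X ^ 2 = ∑ i, ∑ j, X i j ^ 2 :=
  Real.sq_sqrt (by positivity)

/-- A Euclidean bound on `A *ᵥ v` passes to the Frobenius norm of `A * Y`, column by column. -/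
theorem frob_mul_sq_le {n d : ℕ} {A : Matrix (Fin n) (Fin n) ℝ} {σ : ℝ}
    (hA : ∀ v : Fin n → ℝ,
      Real.sqrt (∑ i, (A.mulVec v i) ^ 2) ≤ σ * Real.sqrt (∑ i, (v i) ^ 2))
    (Y : Matrix (Fin n) (Fin d) ℝ) :
    frob (A * Y) ^ 2 ≤ σ ^ 2 * frob Y ^ 2 := by
  rw [frob_sq, frob_sq, Finset.sum_comm, Finset.sum_comm (f := fun i j => Y i j ^ 2),
    Finset.mul_sum]
  refine Finset.sum_le_sum fun j _ => ?_
  have h := pow_le_pow_left₀ (Real.sqrt_nonneg _) (hA fun i => Y i j) 2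
  rw [mul_pow, Real.sq_sqrt (by positivity), Real.sq_sqrt (by positivity)] at h
  exact h

theorem frob_pow_mul_sq_le {n d : ℕ} {A : Matrix (Fin n) (Fin n) ℝ} {σ : ℝ}
    (hA : ∀ v : Fin n → ℝ,
      Real.sqrt (∑ i, (A.mulVec v i) ^ 2) ≤ σ * Real.sqrt (∑ i, (v i) ^ 2))
    (k : ℕ) (Y : Matrix (Fin n) (Fin d) ℝ) :
    frob (A ^ k * Y) ^ 2 ≤ (σ ^ 2) ^ k * frob Y ^ 2 := by
  induction k with
  | zero => simp
  | succ k ih =>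
    rw [pow_succ' A, Matrix.mul_assoc, pow_succ' (σ ^ 2), mul_assoc]
    exact (frob_mul_sq_le hA _).trans (mul_le_mul_of_nonneg_left ih (sq_nonneg σ))

/-- Young's inequality for the squared Frobenius norm. -/
theorem frob_sub_smul_sq_le {n d : ℕ} (X D : Matrix (Fin n) (Fin d) ℝ) (α : ℝ) {η : ℝ}
    (hη : 0 < η) :
    frob (X - α • D) ^ 2 ≤ (1 + η) * frob X ^ 2 + (1 + 1 / η) * α ^ 2 * frob D ^ 2 := by
  simp only [frob_sq, Finset.mul_sum, ← Finset.sum_add_distrib]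
  refine Finset.sum_le_sum fun i _ => Finset.sum_le_sum fun j _ => ?_
  have h : (1 + η) * X i j ^ 2 + (1 + 1 / η) * α ^ 2 * D i j ^ 2 - (X i j - α * D i j) ^ 2
      = (η * X i j + α * D i j) ^ 2 / η := by
    field_simp
    ring
  have h' : 0 ≤ (η * X i j + α * D i j) ^ 2 / η := by positivity
  simp only [Matrix.sub_apply, Matrix.smul_apply, smul_eq_mul]
  linarith

theorem pow_mul_eq_of_mul_eq {M : Type*} [Monoid M] {w p : M} (h : w * p = p) (k : ℕ) :
    w ^ k * p = p := by
  induction k with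
  | zero => simp
  | succ k ih => rw [pow_succ, mul_assoc, h, ih]

theorem mul_pow_eq_of_mul_eq {M : Type*} [Monoid M] {w p : M} (h : p * w = p) (k : ℕ) :
    p * w ^ k = p := by
  induction k with
  | zero => simp
  | succ k ih => rw [pow_succ, ← mul_assoc, ih, h]

theorem sub_pow_succ_of_absorbing {R : Type*} [Ring R] {w p : R} (hwp : w * p = p)
    (hpw : p * w = p) (hpp : p * p = p) (k : ℕ) :
    (w - p) ^ (k + 1) = w ^ (k + 1) - p := by
  induction k with
  | zero => simp
  | succ k ih =>
    rw [pow_succ, ih, sub_mul, mul_sub, mul_sub, pow_mul_eq_of_mul_eq hwp, hpw, hpp, ← pow_succ]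
    simp

/-- Inequality (eq-diff) in the proof of Lemma 3: with
`X' = W^m (X - α D)` and `‖D‖_F ≤ (2/M₁) ‖G‖_F`,
`‖X' - P X'‖_F² ≤ σ^{2m-2} (1+σ²)/2 ‖X - P X‖_F²
  + 8 σ^{2m} α² / ((1-σ²) M₁²) ‖G‖_F²`. -/
theorem stmt_19 (n d m : ℕ) (hn : 1 ≤ n) (hm : 1 ≤ m) (σ α M₁ : ℝ)
    (hσ0 : 0 < σ) (hσ1 : σ < 1) (hα : 0 ≤ α) (hM₁ : 0 < M₁)
    (W P : Matrix (Fin n) (Fin n) ℝ)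
    (hWnn : ∀ i j, 0 ≤ W i j) (hWsymm : W.IsSymm) (hWrow : ∀ i, ∑ j, W i j = 1)
    (hP : ∀ i j, P i j = 1 / (n : ℝ))
    (hσW : ∀ v : Fin n → ℝ,
      Real.sqrt (∑ i, ((W - P).mulVec v i) ^ 2) ≤ σ * Real.sqrt (∑ i, (v i) ^ 2))
    (X D G : Matrix (Fin n) (Fin d) ℝ)
    (hD : frob D ≤ (2 / M₁) * frob G)
    (X' : Matrix (Fin n) (Fin d) ℝ)
    (hX' : X' = W ^ m * (X - α • D)) :
    (frob (X' - P * X')) ^ 2 ≤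
      σ ^ (2 * m - 2) * ((1 + σ ^ 2) / 2) * (frob (X - P * X)) ^ 2
        + (8 * σ ^ (2 * m) * α ^ 2 / ((1 - σ ^ 2) * M₁ ^ 2)) * (frob G) ^ 2 := by
  have hn0 : (n : ℝ) ≠ 0 := by exact_mod_cast (by omega : n ≠ 0)
  have hWP : W * P = P := by
    ext i j
    simp only [Matrix.mul_apply, hP, ← Finset.sum_mul, hWrow, one_mul]
  have hPW : P * W = P := by
    ext i j
    have hcol : ∑ i, W i j = 1 := by
      rw [← hWrow j]
      exact Finset.sum_congr rfl fun i _ => hWsymm.apply j i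
    simp only [Matrix.mul_apply, hP, ← Finset.mul_sum, hcol, mul_one]
  have hPP : P * P = P := by
    ext i j
    simp [Matrix.mul_apply, hP, hn0]
  obtain ⟨k, rfl⟩ : ∃ k, m = k + 1 := ⟨m - 1, by omega⟩
  have hdiff : X' - P * X' = (W - P) ^ (k + 1) * (X - P * X - α • D) := by
    rw [sub_pow_succ_of_absorbing hWP hPW hPP, hX', ← Matrix.mul_assoc,
      mul_pow_eq_of_mul_eq hPW, ← Matrix.sub_mul, sub_right_comm,
      Matrix.mul_sub _ _ (P * X), ← Matrix.mul_assoc, Matrix.sub_mul _ _ P,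
      pow_mul_eq_of_mul_eq hWP, hPP]
    simp
  have hσ : 0 < 1 - σ ^ 2 := by nlinarith
  have hη : 0 < (1 - σ ^ 2) / (2 * σ ^ 2) := by positivity
  have hD2 : frob D ^ 2 ≤ 4 / M₁ ^ 2 * frob G ^ 2 := by
    refine (pow_le_pow_left₀ (Real.sqrt_nonneg _) hD 2).trans_eq ?_
    ring
  have hcoef : 1 + 1 / ((1 - σ ^ 2) / (2 * σ ^ 2)) ≤ 2 / (1 - σ ^ 2) := by
    rw [one_div_div, le_div_iff₀ hσ, add_mul, div_mul_cancel₀ _ hσ.ne']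
    linarith
  have hexp : 2 * (k + 1) - 2 = 2 * k := by omega
  rw [hdiff, hexp]
  calc frob ((W - P) ^ (k + 1) * (X - P * X - α • D)) ^ 2
      ≤ (σ ^ 2) ^ (k + 1) * frob (X - P * X - α • D) ^ 2 := frob_pow_mul_sq_le hσW _ _
    _ ≤ (σ ^ 2) ^ (k + 1) * ((1 + (1 - σ ^ 2) / (2 * σ ^ 2)) * frob (X - P * X) ^ 2
          + 2 / (1 - σ ^ 2) * α ^ 2 * (4 / M₁ ^ 2 * frob G ^ 2)) := by
        refine mul_le_mul_of_nonneg_left ?_ (by positivity)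
        refine (frob_sub_smul_sq_le _ D α hη).trans ?_
        gcongr
    _ = _ := by
        rw [pow_mul, pow_mul]
        field_simp
        ring
end
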